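/- Let (W,S) be a Coxeter system and let 𝒥 be a family of subsets of S whose intersection is empty. For J ⊆ S write x = x^J x_J for the unique decomposition with x^J a minimal-length coset representative of x W_J and x_J ∈ W_J. Then for x, y ∈ W, x ≤ y in the Bruhat order if and only if x^J ≤ y^J for every J ∈ 𝒥. -/

import Mathlib

/-- The Bruhat order on a Coxeter group: `x ≤ y` iff `y` can be obtained from `x` by a
chain of left multiplications by reflections, each strictly increasing the length. -/
def bruhatLE {B W : Type*} [Group W] {M : CoxeterMatrix B} (cs : CoxeterSystem M W)
    (x y : W) : Prop :=
  Relation.ReflTransGen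
    (fun u v => (∃ t : W, cs.IsReflection t ∧ v = t * u) ∧ cs.length u < cs.length v) x y

/-- `m` is the minimal length representative of the coset `x W_J`, where `W_J` is the
standard parabolic subgroup generated by the simple reflections indexed by `J`. -/
def IsMinCosetRep {B W : Type*} [Group W] {M : CoxeterMatrix B} (cs : CoxeterSystem M W)
    (J : Set B) (x m : W) : Prop :=
  m⁻¹ * x ∈ Subgroup.closure (cs.simple '' J) ∧
    ∀ z : W, z⁻¹ * x ∈ Subgroup.closure (cs.simple '' J) → cs.length m ≤ cs.length z


namespace Deodhar

open Module Polynomial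

/-! ### The geometric representation -/

section Geom

variable {B : Type*} (M : CoxeterMatrix B)

/-- The coefficients of the geometric representation. -/
noncomputable def coef (i j : B) : ℝ := -2 * Real.cos (Real.pi / (M i j : ℝ))

/-- The coroot attached to `i`. -/
noncomputable def coroot (i : B) : Dual ℝ (B →₀ ℝ) :=
  Finsupp.linearCombination ℝ (fun j => coef M i j)

theorem coroot_single (i j : B) : coroot M i (Finsupp.single j 1) = coef M i j := by
  simp [coroot]

theorem coroot_self (i : B) : coroot M i (Finsupp.single i 1) = 2 := by
  rw [coroot_single, coef, M.diagonal]; simp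

/-- The geometric reflection. -/
noncomputable def geom (i : B) : (B →₀ ℝ) ≃ₗ[ℝ] (B →₀ ℝ) := reflection (coroot_self M i)

theorem geom_apply (i : B) (v : B →₀ ℝ) :
    geom M i v = v - coroot M i v • Finsupp.single i 1 := by
  simp [geom, reflection_apply]

theorem geom_liftable : M.IsLiftable (geom M) := by
  intro i j
  rcases Nat.lt_or_ge (M i j) 3 with h3 | h3
  · interval_cases h : M i j
    · simp
    · have hij : i = j := by
        by_contra hne
        exact M.off_diagonal i j hne h
      subst hij
      apply LinearEquiv.ext
      intro v
      rw [pow_one, LinearEquiv.mul_apply]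
      exact involutive_reflection (coroot_self M i) v
    · have h' : M j i = 2 := by rw [M.symmetric, h]
      have c1 : coef M i j = 0 := by rw [coef, h]; simp
      have c2 : coef M j i = 0 := by rw [coef, h']; simp
      apply LinearEquiv.ext
      intro v
      simp only [pow_two, LinearEquiv.mul_apply, geom_apply, map_sub, map_smul, coroot_single,
        c1, c2, show coef M i i = 2 from coroot_single M i i ▸ coroot_self M i,
        show coef M j j = 2 from coroot_single M j j ▸ coroot_self M j]
      change _ = v
      module
  · apply LinearEquiv.ext
    intro v
    set m := M i j with hm
    have hm0 : (m : ℝ) ≠ 0 := by positivity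
    have hji : M j i = m := by rw [M.symmetric]
    set θ : ℝ := 2 * Real.pi / m with hθ
    have ht : 2 * Real.cos θ = coroot M i (Finsupp.single j 1) * coroot M j (Finsupp.single i 1)
        - 2 := by
      rw [coroot_single, coroot_single, coef, coef, hji, ← hm, hθ, mul_div_assoc, Real.cos_two_mul]
      ring
    have hs : Real.sin θ ≠ 0 := by
      apply ne_of_gt
      apply Real.sin_pos_of_pos_of_lt_pi
      · positivity
      · rw [hθ, div_lt_iff₀ (by positivity)]
        have : (3 : ℝ) ≤ m := by exact_mod_cast h3
        nlinarith [Real.pi_pos]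
    have hS : ∀ n : ℤ, (Chebyshev.S ℝ n).eval (2 * Real.cos θ) = Real.sin ((n + 1) * θ) / Real.sin θ := by
      intro n
      rw [eq_div_iff hs]
      exact Chebyshev.S_two_mul_real_cos θ n
    rw [geom, geom, reflection_mul_reflection_pow_apply _ _ m v (2 * Real.cos θ) ht]
    simp only [hS]
    have hmθ : m * θ = 2 * Real.pi := by rw [hθ]; field_simp
    rcases Nat.even_or_odd' m with ⟨k, hk | hk⟩
    · have e1 : ((m : ℤ) - 2) / 2 = k - 1 := by omega
      have e2 : ((m : ℤ) - 1) / 2 = k - 1 := by omega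
      have hkk : (k : ℝ) * θ = Real.pi := by
        rw [hk] at hmθ; push_cast at hmθ; linarith
      rw [e1, e2]
      simp [hkk]
    · have e1 : ((m : ℤ) - 2) / 2 = k - 1 := by omega
      have e2 : ((m : ℤ) - 1) / 2 = k := by omega
      have e3 : ((m : ℤ) - 3) / 2 = k - 1 := by omega
      have e4 : (m : ℤ) / 2 = k := by omega
      have hkk : ((k : ℝ) + 1) * θ = 2 * Real.pi - k * θ := by
        rw [hk] at hmθ; push_cast at hmθ; linarith
      rw [e1, e2, e3, e4]
      simp [hkk, Real.sin_two_pi_sub, neg_div]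

end Geom

section Cox

variable {B W : Type*} [Group W] {M : CoxeterMatrix B} (cs : CoxeterSystem M W)

/-- A simple reflection lying in `W_J` is indexed by an element of `J`. -/
theorem mem_of_simple_mem {J : Set B} {i : B}
    (h : cs.simple i ∈ Subgroup.closure (cs.simple '' J)) : i ∈ J := by
  classical
  let ρ := cs.lift ⟨geom M, geom_liftable M⟩
  have hρ : ∀ i, ρ (cs.simple i) = geom M i := fun i => cs.lift_apply_simple (geom_liftable M) i
  by_contra hi
  have key : ∀ w ∈ Subgroup.closure (cs.simple '' J), ∀ v : B →₀ ℝ, (ρ w v) i = v i := by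
    intro w hw
    induction hw using Subgroup.closure_induction with
    | mem x hx =>
      obtain ⟨j, hj, rfl⟩ := hx
      intro v
      have : j ≠ i := fun e => hi (e ▸ hj)
      simp [hρ, geom_apply, Finsupp.single_apply, this]
    | one => simp
    | mul x y _ _ hx hy => intro v; rw [map_mul, LinearEquiv.mul_apply, hx, hy]
    | inv x _ hx =>
      intro v
      rw [← hx, ← LinearEquiv.mul_apply, ← map_mul]; simp
  have := key _ h (Finsupp.single i 1)
  rw [hρ, geom_apply, coroot_self] at this
  simp at this

/-! ### The reflection cocycle -/

open Classical in
/-- Action of a simple reflection on signed elements. -/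
noncomputable def sgnFun (i : B) (p : W × ZMod 2) : W × ZMod 2 :=
  (cs.simple i * p.1 * cs.simple i, p.2 + if p.1 = cs.simple i then 1 else 0)

theorem sgnFun_invol (i : B) : Function.Involutive (sgnFun cs i) := by
  rintro ⟨t, e⟩
  have h : cs.simple i * t * cs.simple i = cs.simple i ↔ t = cs.simple i := by
    constructor
    · intro h
      have := congrArg (fun z => cs.simple i * z * cs.simple i) h
      simpa [mul_assoc] using this
    · rintro rfl; simp
  by_cases ht : t = cs.simple i
  · subst ht
    simp [sgnFun, add_assoc]
    decide
  · have hnot : ¬ cs.simple i * t * cs.simple i = cs.simple i := fun e => ht (h.1 e)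
    simp only [sgnFun, if_neg ht]
    simp [mul_assoc]
    exact if_neg hnot

/-- The permutation of signed elements attached to a simple reflection. -/
noncomputable def sgnPerm (i : B) : Equiv.Perm (W × ZMod 2) := (sgnFun_invol cs i).toPerm

theorem sgnPerm_apply (i : B) (p : W × ZMod 2) : sgnPerm cs i p = sgnFun cs i p := rfl

open Classical in
theorem sgn_pow (i j : B) (k : ℕ) (t : W) (e : ZMod 2) :
    ((sgnPerm cs i * sgnPerm cs j) ^ k) (t, e) =
      ((cs.simple i * cs.simple j) ^ k * t * ((cs.simple i * cs.simple j) ^ k)⁻¹,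
        e + ∑ n ∈ Finset.range (2 * k),
          if t = cs.simple j * (cs.simple i * cs.simple j) ^ n then 1 else 0) := by
  induction k with
  | zero => simp
  | succ k ih =>
    rw [pow_succ', Equiv.Perm.mul_apply, ih, Equiv.Perm.mul_apply, sgnPerm_apply, sgnPerm_apply]
    set c := cs.simple i * cs.simple j with hc
    have hjc : ∀ n : ℕ, cs.simple j * c ^ n * cs.simple j = (c ^ n)⁻¹ := by
      intro n
      have h1 : cs.simple j * c * (cs.simple j)⁻¹ = c⁻¹ := by simp [hc, mul_assoc]
      have h2 := conj_pow (i := n) (a := cs.simple j) (b := c)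
      rw [h1] at h2
      rw [← inv_pow, h2]; simp
    have hjc' : ∀ n : ℕ, (c ^ n)⁻¹ * cs.simple j = cs.simple j * c ^ n := by
      intro n; rw [← hjc]; simp [mul_assoc]
    have hA : c ^ k * t * (c ^ k)⁻¹ = cs.simple j ↔ t = cs.simple j * c ^ (2 * k) := by
      rw [two_mul, pow_add, ← mul_assoc, ← hjc', mul_inv_eq_iff_eq_mul, mul_assoc,
        eq_inv_mul_iff_mul_eq]
    have hB : cs.simple j * (c ^ k * t * (c ^ k)⁻¹) * cs.simple j = cs.simple i ↔
        t = cs.simple j * c ^ (2 * k + 1) := by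
      have e1 : cs.simple j * c ^ (2 * k + 1) = (c ^ k)⁻¹ * (cs.simple j * c) * c ^ k := by
        rw [show 2 * k + 1 = k + 1 + k by ring, pow_add, pow_succ, ← mul_assoc, ← mul_assoc,
          ← hjc', mul_assoc _ (cs.simple j) c]
      have e2 : cs.simple j * c = cs.simple j * cs.simple i * cs.simple j := by
        rw [hc, mul_assoc]
      rw [e1, e2]
      constructor
      · intro h
        rw [← h]; simp [mul_assoc]
      · rintro rfl
        simp [mul_assoc]
    rw [show 2 * (k + 1) = 2 * k + 1 + 1 by ring, Finset.sum_range_succ, Finset.sum_range_succ]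
    ext
    · simp [sgnFun, pow_succ', mul_assoc, hc]
    · simp only [sgnFun, hA, hB]
      ring

theorem sgn_liftable : M.IsLiftable (sgnPerm cs) := by
  classical
  intro i j
  ext1 ⟨t, e⟩
  rw [sgn_pow, cs.simple_mul_simple_pow, two_mul, Finset.sum_range_add]
  have : ∀ n, (cs.simple i * cs.simple j) ^ (M i j + n) = (cs.simple i * cs.simple j) ^ n := by
    intro n; rw [pow_add, cs.simple_mul_simple_pow, one_mul]
  simp only [this]
  simp [CharTwo.add_self_eq_zero]

/-- The signed permutation representation. -/
noncomputable def sgn : W →* Equiv.Perm (W × ZMod 2) := cs.lift ⟨sgnPerm cs, sgn_liftable cs⟩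

theorem sgn_simple (i : B) : sgn cs (cs.simple i) = sgnPerm cs i :=
  cs.lift_apply_simple (sgn_liftable cs) i

/-- The cocycle: parity of the number of occurrences of `t` in the right inversion sequence. -/
noncomputable def N (w t : W) : ZMod 2 := (sgn cs w (t, 0)).2

theorem sgn_apply (w t : W) (e : ZMod 2) : sgn cs w (t, e) = (w * t * w⁻¹, e + N cs w t) := by
  have key : ∀ t, ∃ n, ∀ e, sgn cs w (t, e) = (w * t * w⁻¹, e + n) := by
    induction w using cs.simple_induction_left with
    | one => exact fun t => ⟨0, by simp⟩
    | mul_simple_left w i ih =>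
      intro t
      obtain ⟨n, hn⟩ := ih t
      classical
      refine ⟨n + if w * t * w⁻¹ = cs.simple i then 1 else 0, fun e => ?_⟩
      rw [map_mul, Equiv.Perm.mul_apply, hn, sgn_simple, sgnPerm_apply]
      simp [sgnFun, mul_assoc, add_assoc]
  obtain ⟨n, hn⟩ := key t
  rw [N, hn, hn]; simp

theorem N_mul (v w t : W) : N cs (v * w) t = N cs w t + N cs v (w * t * w⁻¹) := by
  rw [N, map_mul, Equiv.Perm.mul_apply, sgn_apply, sgn_apply]; simp

open Classical in
theorem N_simple (i : B) (t : W) : N cs (cs.simple i) t = if t = cs.simple i then 1 else 0 := by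
  rw [N, sgn_simple, sgnPerm_apply]; simp [sgnFun]

theorem N_one (t : W) : N cs 1 t = 0 := by simp [N]

theorem N_self {t : W} (ht : cs.IsReflection t) : N cs t t = 1 := by
  obtain ⟨w, i, rfl⟩ := ht
  have h := N_mul cs w w⁻¹ (w * cs.simple i * w⁻¹)
  rw [mul_inv_cancel, N_one] at h
  rw [N_mul, N_mul, N_simple]
  simp [mul_assoc] at h ⊢
  rw [add_left_comm, ← h]; simp

theorem mem_ris_of_N {ω : List B} {t : W} (h : N cs (cs.wordProd ω) t ≠ 0) :
    t ∈ cs.rightInvSeq ω := by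
  classical
  induction ω with
  | nil => simp [N_one] at h
  | cons i ω ih =>
    rw [CoxeterSystem.rightInvSeq, List.mem_cons]
    by_cases h0 : N cs (cs.wordProd ω) t = 0
    · left
      rw [cs.wordProd_cons, N_mul, h0, N_simple] at h
      by_cases h1 : cs.wordProd ω * t * (cs.wordProd ω)⁻¹ = cs.simple i
      · rw [← h1]; simp [mul_assoc]
      · simp [h1] at h
    · right; exact ih h0

theorem length_lt_of_N {w t : W} (h : N cs w t ≠ 0) : cs.length (w * t) < cs.length w := by
  obtain ⟨ω, hω, rfl⟩ := cs.exists_isReduced w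
  exact (cs.isRightInversion_of_mem_rightInvSeq hω (mem_ris_of_N cs h)).2

theorem N_iff {w t : W} (ht : cs.IsReflection t) :
    N cs w t ≠ 0 ↔ cs.length (w * t) < cs.length w := by
  refine ⟨length_lt_of_N cs, fun h h0 => ?_⟩
  have h1 : N cs (w * t) t = 1 := by
    rw [N_mul, N_self cs ht]; simp [h0]
  have h2 := length_lt_of_N cs (w := w * t) (t := t) (by rw [h1]; decide)
  rw [mul_assoc, ht.mul_self, mul_one] at h2
  omega

/-- Key exchange step: multiplying an edge by a simple reflection. -/
theorem edge_simple {t u : W} (ht : cs.IsReflection t) (i : B) (hne : t ≠ cs.simple i)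
    (h : cs.length u < cs.length (t * u)) :
    cs.length (cs.simple i * u) < cs.length (cs.simple i * (t * u)) := by
  have key : ∀ (t u : W), cs.IsReflection t →
      (cs.length (t * u) < cs.length u ↔ N cs u⁻¹ t ≠ 0) := by
    intro t u ht
    rw [N_iff cs ht, ← cs.length_inv (t * u), ← cs.length_inv u, mul_inv_rev, ht.inv]
  have ht' : cs.IsReflection (cs.simple i * t * cs.simple i) := by
    simpa using ht.conj (cs.simple i)
  have e : cs.simple i * (t * u) = (cs.simple i * t * cs.simple i) * (cs.simple i * u) := by
    simp [mul_assoc]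
  have hno : ¬ cs.length (t * u) < cs.length u := by omega
  rw [key t u ht, not_not] at hno
  have hno' : N cs (cs.simple i * u)⁻¹ (cs.simple i * t * cs.simple i) = 0 := by
    classical
    have : cs.simple i * t * cs.simple i ≠ cs.simple i := by
      intro h
      apply hne
      have := congrArg (fun z => cs.simple i * z * cs.simple i) h
      simpa [mul_assoc] using this
    rw [mul_inv_rev, N_mul, cs.inv_simple, N_simple, if_neg this]
    simpa [mul_assoc] using hno
  have h2 := (key _ (cs.simple i * u) ht').not
  rw [hno', ← e] at h2
  have h3 := ht'.length_mul_right_ne (cs.simple i * u)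
  rw [← e] at h3
  simp at h2
  omega

/-- In `W_J`, right descents are in `J`. -/
theorem descent_mem {J : Set B} {x : W} (hx : x ∈ Subgroup.closure (cs.simple '' J)) {i : B}
    (hi : cs.length (x * cs.simple i) < cs.length x) : i ∈ J := by
  have hw : ∃ ω : List B, (∀ j ∈ ω, j ∈ J) ∧ x = cs.wordProd ω := by
    clear hi
    induction hx using Subgroup.closure_induction with
    | mem x hx =>
      obtain ⟨j, hj, rfl⟩ := hx
      exact ⟨[j], by simpa using hj, by simp⟩
    | one => exact ⟨[], by simp, by simp⟩
    | mul x y _ _ hx hy =>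
      obtain ⟨a, ha, rfl⟩ := hx
      obtain ⟨b, hb, rfl⟩ := hy
      refine ⟨a ++ b, ?_, by rw [cs.wordProd_append]⟩
      intro j hj
      rcases List.mem_append.1 hj with h | h
      exacts [ha j h, hb j h]
    | inv x _ hx =>
      obtain ⟨a, ha, rfl⟩ := hx
      exact ⟨a.reverse, by simpa using ha, by rw [cs.wordProd_reverse]⟩
  obtain ⟨ω, hω, rfl⟩ := hw
  have hmem := mem_ris_of_N cs ((N_iff cs (cs.isReflection_simple i)).2 hi)
  apply mem_of_simple_mem cs
  clear hi hx
  have hprod : ∀ ω : List B, (∀ j ∈ ω, j ∈ J) →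
      cs.wordProd ω ∈ Subgroup.closure (cs.simple '' J) := by
    intro ω
    induction ω with
    | nil => simp [one_mem]
    | cons j ω ih =>
      intro h
      rw [cs.wordProd_cons]
      exact mul_mem (Subgroup.subset_closure ⟨j, h j (by simp), rfl⟩)
        (ih fun k hk => h k (by simp [hk]))
  induction ω with
  | nil => simp at hmem
  | cons j ω ih =>
    rw [CoxeterSystem.rightInvSeq, List.mem_cons] at hmem
    rcases hmem with h | h
    · rw [h]
      have h1 := hprod ω fun k hk => hω k (by simp [hk])
      exact mul_mem (mul_mem (inv_mem h1) (Subgroup.subset_closure ⟨j, hω j (by simp), rfl⟩)) h1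
    · exact ih (fun k hk => hω k (by simp [hk])) h

/-! ### Bruhat order -/

theorem le_length {x y : W} (h : bruhatLE cs x y) :
    x = y ∨ cs.length x < cs.length y := by
  induction h with
  | refl => exact Or.inl rfl
  | tail _ h ih => rcases ih with rfl | ih
                   · exact Or.inr h.2
                   · exact Or.inr (ih.trans h.2)

theorem le_refl' (x : W) : bruhatLE cs x x := Relation.ReflTransGen.refl

variable {cs} in
theorem le_trans' {x y z : W} (h : bruhatLE cs x y) (h' : bruhatLE cs y z) : bruhatLE cs x z :=
  Relation.ReflTransGen.trans h h'

theorem le_antisymm' {x y : W} (h : bruhatLE cs x y) (h' : bruhatLE cs y x) : x = y := by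
  rcases le_length cs h with h | h
  · exact h
  · rcases le_length cs h' with h' | h'
    · exact h'.symm
    · omega

theorem le_inv {x y : W} (h : bruhatLE cs x y) : bruhatLE cs x⁻¹ y⁻¹ := by
  refine Relation.ReflTransGen.lift (fun w : W => w⁻¹) ?_ _ _ h
  rintro u _ ⟨⟨t, ht, rfl⟩, hl⟩
  refine ⟨⟨u⁻¹ * t * u, by simpa using ht.conj u⁻¹, ?_⟩, by rwa [cs.length_inv, cs.length_inv]⟩
  simp [ht.inv, mul_assoc]

theorem le_simple_mul {x : W} {i : B} (h : cs.length x < cs.length (cs.simple i * x)) :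
    bruhatLE cs x (cs.simple i * x) :=
  Relation.ReflTransGen.single ⟨⟨_, cs.isReflection_simple i, rfl⟩, h⟩

open Classical in
/-- The smaller of `x` and `s x`. -/
noncomputable def lmin (i : B) (x : W) : W :=
  if cs.length x < cs.length (cs.simple i * x) then x else cs.simple i * x

open Classical in
/-- The larger of `x` and `s x`. -/
noncomputable def lmax (i : B) (x : W) : W :=
  if cs.length x < cs.length (cs.simple i * x) then cs.simple i * x else x

theorem simple_mul_le {x : W} {i : B} (h : ¬ cs.length x < cs.length (cs.simple i * x)) :
    bruhatLE cs (cs.simple i * x) x := by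
  have h1 := cs.length_simple_mul_ne x i
  have := le_simple_mul cs (x := cs.simple i * x) (i := i)
    (by rw [cs.simple_mul_simple_cancel_left]; omega)
  rwa [cs.simple_mul_simple_cancel_left] at this

theorem lmin_le (i : B) (x : W) :
    bruhatLE cs (lmin cs i x) x ∧ bruhatLE cs (lmin cs i x) (cs.simple i * x) := by
  unfold lmin
  split_ifs with h
  · exact ⟨le_refl' _ _, le_simple_mul cs h⟩
  · exact ⟨simple_mul_le cs h, le_refl' _ _⟩

theorem le_lmax (i : B) (x : W) :
    bruhatLE cs x (lmax cs i x) ∧ bruhatLE cs (cs.simple i * x) (lmax cs i x) := by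
  unfold lmax
  split_ifs with h
  · exact ⟨le_simple_mul cs h, le_refl' _ _⟩
  · exact ⟨le_refl' _ _, simple_mul_le cs h⟩

theorem le_lmin {i : B} {z x : W} (h1 : bruhatLE cs z x) (h2 : bruhatLE cs z (cs.simple i * x)) :
    bruhatLE cs z (lmin cs i x) := by
  unfold lmin
  split_ifs <;> assumption

theorem lmax_le {i : B} {z x : W} (h1 : bruhatLE cs x z) (h2 : bruhatLE cs (cs.simple i * x) z) :
    bruhatLE cs (lmax cs i x) z := by
  unfold lmax
  split_ifs <;> assumption

theorem edge_cases {u v : W} (i : B) (h : (∃ t : W, cs.IsReflection t ∧ v = t * u) ∧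
    cs.length u < cs.length v) :
    v = cs.simple i * u ∨ bruhatLE cs (cs.simple i * u) (cs.simple i * v) := by
  obtain ⟨⟨t, ht, rfl⟩, hl⟩ := h
  by_cases hne : t = cs.simple i
  · left; rw [hne]
  · right
    refine Relation.ReflTransGen.single ⟨⟨cs.simple i * t * cs.simple i, ?_, ?_⟩,
      edge_simple cs ht i hne hl⟩
    · simpa using ht.conj (cs.simple i)
    · simp [mul_assoc]

theorem lmin_mono (i : B) {x y : W} (h : bruhatLE cs x y) :
    bruhatLE cs (lmin cs i x) (lmin cs i y) := by
  induction h with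
  | refl => exact le_refl' _ _
  | @tail u v _ h ih =>
    refine le_trans' ih ?_
    have huv : bruhatLE cs u v := Relation.ReflTransGen.single h
    have hmin := lmin_le cs i u
    apply le_lmin
    · exact le_trans' hmin.1 huv
    · rcases edge_cases cs i h with rfl | h'
      · rw [cs.simple_mul_simple_cancel_left]; exact hmin.1
      · exact le_trans' hmin.2 h'

theorem lmax_mono (i : B) {x y : W} (h : bruhatLE cs x y) :
    bruhatLE cs (lmax cs i x) (lmax cs i y) := by
  induction h with
  | refl => exact le_refl' _ _
  | @tail u v _ h ih =>
    refine le_trans' ih ?_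
    have huv : bruhatLE cs u v := Relation.ReflTransGen.single h
    have hmax := le_lmax cs i v
    apply lmax_le
    · exact le_trans' huv hmax.1
    · rcases edge_cases cs i h with rfl | h'
      · exact hmax.1
      · have hs := le_trans' h' hmax.2
        exact hs

/-- The smaller of `x` and `x s`. -/
noncomputable def rmin (i : B) (x : W) : W := (lmin cs i x⁻¹)⁻¹

theorem rmin_mono (i : B) {x y : W} (h : bruhatLE cs x y) :
    bruhatLE cs (rmin cs i x) (rmin cs i y) :=
  le_inv cs (lmin_mono cs i (le_inv cs h))

theorem rmin_le (i : B) (x : W) :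
    bruhatLE cs (rmin cs i x) x ∧ bruhatLE cs (rmin cs i x) (x * cs.simple i) := by
  have h := lmin_le cs i x⁻¹
  have h1 := le_inv cs h.1
  have h2 := le_inv cs h.2
  simp only [mul_inv_rev, inv_inv, cs.inv_simple] at h1 h2
  exact ⟨h1, h2⟩

theorem length_simple_mul_inv (i : B) (x : W) :
    cs.length (cs.simple i * x⁻¹) = cs.length (x * cs.simple i) := by
  rw [← cs.length_inv]; simp

theorem rmin_of_lt {i : B} {x : W} (h : cs.length x < cs.length (x * cs.simple i)) :
    rmin cs i x = x := by
  rw [rmin, lmin, if_pos, inv_inv]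
  rwa [length_simple_mul_inv, cs.length_inv]

theorem rmin_of_gt {i : B} {x : W} (h : cs.length (x * cs.simple i) < cs.length x) :
    rmin cs i x = x * cs.simple i := by
  rw [rmin, lmin, if_neg]
  · simp
  · rw [length_simple_mul_inv, cs.length_inv]; omega

theorem rmin_cases (i : B) (x : W) : rmin cs i x = x ∨ rmin cs i x = x * cs.simple i := by
  rw [rmin, lmin]; split_ifs <;> simp

/-! ### Minimal coset representatives -/

/-- No right descents in `J`. -/
def NoDesc (J : Set B) (a : W) : Prop := ∀ j ∈ J, cs.length a < cs.length (a * cs.simple j)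

theorem NoDesc.le {J : Set B} {a : W} (ha : NoDesc cs J a) {w : W}
    (hw : w ∈ Subgroup.closure (cs.simple '' J)) : bruhatLE cs a (a * w) := by
  have step : ∀ j ∈ J, ∀ z, bruhatLE cs a z → bruhatLE cs a (z * cs.simple j) := by
    intro j hj z hz
    have := rmin_mono cs j hz
    rw [rmin_of_lt cs (ha j hj)] at this
    exact le_trans' this (rmin_le cs j z).2
  induction hw using Subgroup.closure_induction_right with
  | one => rw [mul_one]; exact le_refl' _ _
  | mul_right x _ y hy ih =>
    obtain ⟨j, hj, rfl⟩ := hy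
    rw [← mul_assoc]; exact step j hj _ ih
  | mul_inv_cancel x _ y hy ih =>
    obtain ⟨j, hj, rfl⟩ := hy
    rw [cs.inv_simple, ← mul_assoc]; exact step j hj _ ih

theorem simple_mem {J : Set B} {j : B} (hj : j ∈ J) :
    cs.simple j ∈ Subgroup.closure (cs.simple '' J) := Subgroup.subset_closure ⟨j, hj, rfl⟩

theorem isMin_noDesc {J : Set B} {x m : W} (h : IsMinCosetRep cs J x m) : NoDesc cs J m := by
  intro j hj
  have h1 := h.2 (m * cs.simple j) (by
    rw [mul_inv_rev, mul_assoc, cs.inv_simple]; exact mul_mem (simple_mem cs hj) h.1)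
  have h2 := cs.length_mul_simple_ne m j
  omega

theorem isMin_of_noDesc {J : Set B} {x m : W} (h : NoDesc cs J m)
    (hm : m⁻¹ * x ∈ Subgroup.closure (cs.simple '' J)) : IsMinCosetRep cs J x m := by
  refine ⟨hm, fun z hz => ?_⟩
  have h1 := h.le cs (mul_mem hm (inv_mem hz))
  have e : m * (m⁻¹ * x * (z⁻¹ * x)⁻¹) = z := by group
  rw [e] at h1
  rcases le_length cs h1 with h | h
  · rw [h]
  · exact h.le

theorem isMin_le {J : Set B} {x m z : W} (h : IsMinCosetRep cs J x m)
    (hz : z⁻¹ * x ∈ Subgroup.closure (cs.simple '' J)) : bruhatLE cs m z := by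
  have h1 := (isMin_noDesc cs h).le cs (mul_mem h.1 (inv_mem hz))
  have e : m * (m⁻¹ * x * (z⁻¹ * x)⁻¹) = z := by group
  rwa [e] at h1

theorem isMin_unique {J : Set B} {x m m' : W} (h : IsMinCosetRep cs J x m)
    (h' : IsMinCosetRep cs J x m') : m = m' :=
  le_antisymm' cs (isMin_le cs h h'.1) (isMin_le cs h' h.1)

theorem isMin_exists (J : Set B) (x : W) : ∃ m, IsMinCosetRep cs J x m := by
  have hne : {z : W | z⁻¹ * x ∈ Subgroup.closure (cs.simple '' J)}.Nonempty :=
    ⟨x, by simp [one_mem]⟩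
  refine ⟨Function.argminOn cs.length _ hne, Function.argminOn_mem cs.length _ hne, ?_⟩
  intro z hz
  exact Function.argminOn_le cs.length {z : W | z⁻¹ * x ∈ Subgroup.closure (cs.simple '' J)} hz

theorem isMin_congr {J : Set B} {x y m : W} (h : IsMinCosetRep cs J x m)
    (hxy : x⁻¹ * y ∈ Subgroup.closure (cs.simple '' J)) : IsMinCosetRep cs J y m := by
  apply isMin_of_noDesc cs (isMin_noDesc cs h)
  have := mul_mem h.1 hxy
  rwa [show m⁻¹ * x * (x⁻¹ * y) = m⁻¹ * y by group] at this

theorem proj_mono {J : Set B} : ∀ (n : ℕ) {x y mx my : W}, cs.length y = n → bruhatLE cs x y →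
    IsMinCosetRep cs J x mx → IsMinCosetRep cs J y my → bruhatLE cs mx my := by
  intro n
  induction n using Nat.strong_induction_on with
  | _ n ih =>
    intro x y mx my hn hxy hx hy
    by_cases hnd : NoDesc cs J y
    · have : my = y := isMin_unique cs hy (isMin_of_noDesc cs hnd (by simp [one_mem]))
      rw [this]
      exact le_trans' (isMin_le cs hx (by simp [one_mem])) hxy
    · unfold NoDesc at hnd
      push Not at hnd
      obtain ⟨j, hj, hle⟩ := hnd
      have hlt : cs.length (y * cs.simple j) < cs.length y :=
        lt_of_le_of_ne hle (cs.length_mul_simple_ne y j)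
      have h1 := rmin_mono cs j hxy
      rw [rmin_of_gt cs hlt] at h1
      refine ih _ (hn ▸ hlt) rfl h1 (isMin_congr cs hx ?_) (isMin_congr cs hy ?_)
      · rcases rmin_cases cs j x with h | h <;> rw [h]
        · simp [one_mem]
        · rw [inv_mul_cancel_left]; exact simple_mem cs hj
      · rw [inv_mul_cancel_left]; exact simple_mem cs hj

/-- The inductive step of the nontrivial direction. -/
theorem proj_lmin {J : Set B} {x y a b c d : W} {i : B}
    (ha : IsMinCosetRep cs J x a) (hb : IsMinCosetRep cs J y b)
    (hc : IsMinCosetRep cs J (lmin cs i x) c) (hd : IsMinCosetRep cs J (cs.simple i * y) d)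
    (hab : bruhatLE cs a b) : bruhatLE cs c d := by
  have hca : bruhatLE cs c a := proj_mono cs _ rfl (lmin_le cs i x).1 hc ha
  by_cases hnd : NoDesc cs J (cs.simple i * b)
  · have hd' : IsMinCosetRep cs J (cs.simple i * y) (cs.simple i * b) := by
      apply isMin_of_noDesc cs hnd
      have := hb.1
      simpa [mul_assoc] using this
    have : d = cs.simple i * b := isMin_unique cs hd hd'
    rw [this]
    obtain ⟨e, he⟩ := isMin_exists cs J (cs.simple i * x)
    have hce : bruhatLE cs c e := proj_mono cs _ rfl (lmin_le cs i x).2 hc he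
    have hea : bruhatLE cs e (cs.simple i * a) := by
      apply isMin_le cs he
      have := ha.1
      simpa [mul_assoc] using this
    have h1 := le_lmin cs hca (le_trans' hce hea)
    exact le_trans' (le_trans' h1 (lmin_mono cs i hab)) (lmin_le cs i b).2
  · unfold NoDesc at hnd
    push Not at hnd
    obtain ⟨j, hj, hle⟩ := hnd
    have hbj := isMin_noDesc cs hb j hj
    have ht : cs.IsReflection (b * cs.simple j * b⁻¹) := (cs.isReflection_simple j).conj b
    have heq : b * cs.simple j * b⁻¹ = cs.simple i := by
      by_contra hne
      have := edge_simple cs ht i hne (u := b) (by simpa using hbj)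
      simp only [inv_mul_cancel_right] at this
      rw [← mul_assoc] at this
      omega
    have : d = b := by
      refine isMin_unique cs hd (isMin_of_noDesc cs (isMin_noDesc cs hb) ?_)
      rw [← heq, show b⁻¹ * (b * cs.simple j * b⁻¹ * y) = cs.simple j * (b⁻¹ * y) by group]
      exact mul_mem (simple_mem cs hj) hb.1
    rw [this]
    exact le_trans' hca hab

theorem deodhar_aux (𝒥 : Set (Set B)) (h𝒥 : ⋂₀ 𝒥 = ∅) : ∀ (n : ℕ) (x y : W),
    cs.length y = n →
    (∀ J ∈ 𝒥, ∀ mx my : W, IsMinCosetRep cs J x mx → IsMinCosetRep cs J y my →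
        bruhatLE cs mx my) → bruhatLE cs x y := by
  intro n
  induction n using Nat.strong_induction_on with
  | _ n ih =>
    intro x y hn h
    by_cases hy1 : y = 1
    · subst hy1
      have hx1 : x = 1 := by
        by_contra hx
        obtain ⟨i, hi⟩ := cs.exists_rightDescent_of_ne_one hx
        have : i ∉ ⋂₀ 𝒥 := by simp [h𝒥]
        rw [Set.mem_sInter] at this
        push Not at this
        obtain ⟨J, hJ, hiJ⟩ := this
        obtain ⟨m, hm⟩ := isMin_exists cs J x
        have h1 : IsMinCosetRep cs J 1 (1 : W) := ⟨by simp [one_mem], by simp⟩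
        have hm1 : m = 1 := by
          rcases le_length cs (h J hJ m 1 hm h1) with h | h
          · exact h
          · simp at h
        have hxJ := hm.1
        rw [hm1] at hxJ
        exact hiJ (descent_mem cs (by simpa using hxJ) hi)
      rw [hx1]; exact le_refl' _ _
    · obtain ⟨i, hi⟩ := cs.exists_leftDescent_of_ne_one hy1
      have hi' : cs.length (cs.simple i * y) < cs.length y := hi
      have hrec : bruhatLE cs (lmin cs i x) (cs.simple i * y) := by
        refine ih _ (hn ▸ hi') _ _ rfl ?_
        intro J hJ c d hc hd
        obtain ⟨a, ha⟩ := isMin_exists cs J x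
        obtain ⟨b, hb⟩ := isMin_exists cs J y
        exact proj_lmin cs ha hb hc hd (h J hJ a b ha hb)
      have h1 := lmax_mono cs i hrec
      have h2 : lmax cs i (cs.simple i * y) = y := by
        rw [lmax, cs.simple_mul_simple_cancel_left, if_pos hi']
      rw [h2] at h1
      have h3 := le_lmax cs i (lmin cs i x)
      have h4 : x = lmin cs i x ∨ x = cs.simple i * lmin cs i x := by
        rw [lmin]; split_ifs <;> simp
      refine le_trans' ?_ h1
      rcases h4 with h4 | h4
      · rw [← h4] at h3 ⊢; exact h3.1
      · rw [← h4] at h3; exact h3.2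

end Cox

end Deodhar

/-- **Deodhar's lemma.** Let `𝒥` be a family of subsets of `S` with empty intersection.
Then `x ≤ y` in the Bruhat order iff `x^J ≤ y^J` for every `J ∈ 𝒥`, where `x^J` denotes
the minimal length representative of `x W_J`. -/
theorem deodhar_lemma {B W : Type*} [Group W] {M : CoxeterMatrix B}
    (cs : CoxeterSystem M W) (𝒥 : Set (Set B)) (h𝒥 : ⋂₀ 𝒥 = ∅) (x y : W) :
    bruhatLE cs x y ↔
      ∀ J ∈ 𝒥, ∀ mx my : W, IsMinCosetRep cs J x mx → IsMinCosetRep cs J y my →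
        bruhatLE cs mx my := by
  constructor
  · intro h J _ mx my hx hy
    exact Deodhar.proj_mono cs _ rfl h hx hy
  · exact Deodhar.deodhar_aux cs 𝒥 h𝒥 _ x y rfl
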